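/- Let p be a prime and m a positive integer with m ≤ p. Define f : Z_p → Z_m by f(x) = (lift_p(x)) mod m. Then for every y ∈ Z_m there exists i ∈ {0,1,...,m−1} such that f^{−1}(y) = { (i + k·m) mod p : k ∈ Z, 0 ≤ k < (p − i)/m }, and consequently the set m^{−1}·f^{−1}(y) = { m^{−1}·z : z ∈ f^{−1}(y) } (where m^{−1} is the inverse of m in Z_p) is an interval in Z_p of size at most ⌈p/m⌉. -/

import Mathlib

/-- The interval `I_p(t,s) = {t mod p, (t+1) mod p, …, (t+s−1) mod p}` in `Z_p`. -/
def Ival (p : ℕ) (t : ℤ) (s : ℕ) : Finset (ZMod p) :=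
  (Finset.range s).image (fun j : ℕ => ((t + (j : ℤ) : ℤ) : ZMod p))

theorem lt_ceil_sub_div_iff {p m i k : ℕ} (hm : 0 < m) :
    k < Nat.ceil (((p : ℚ) - (i : ℚ)) / (m : ℚ)) ↔ i + k * m < p := by
  have hm' : (0 : ℚ) < m := by exact_mod_cast hm
  rw [Nat.lt_ceil, lt_div_iff₀ hm', lt_sub_iff_add_lt']
  exact_mod_cast Iff.rfl

theorem filter_val_cast_eq_image (p m : ℕ) [NeZero p] [NeZero m] (y : ZMod m) :
    Finset.univ.filter (fun x : ZMod p => ((ZMod.val x : ℕ) : ZMod m) = y)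
      = (Finset.range (Nat.ceil (((p : ℚ) - (y.val : ℚ)) / (m : ℚ)))).image
          (fun k : ℕ => ((y.val + k * m : ℕ) : ZMod p)) := by
  ext x
  simp only [Finset.mem_filter, Finset.mem_univ, true_and, Finset.mem_image, Finset.mem_range,
    lt_ceil_sub_div_iff (NeZero.pos m)]
  constructor
  · rintro rfl
    have h : x.val % m + x.val / m * m = x.val := Nat.mod_add_div' _ _
    refine ⟨x.val / m, ?_, ?_⟩
    · rw [ZMod.val_natCast, h]
      exact x.val_lt
    · rw [ZMod.val_natCast, h, ZMod.natCast_zmod_val]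
  · rintro ⟨k, hk, rfl⟩
    rw [ZMod.val_natCast_of_lt hk]
    simp

theorem inv_mul_natCast_add_mul {p m i k : ℕ} (hp : p.Prime) (hm : 0 < m) (hmp : m ≤ p)
    (hk : i + k * m < p) :
    (m : ZMod p)⁻¹ * ((i + k * m : ℕ) : ZMod p) = (m : ZMod p)⁻¹ * i + k := by
  have : Fact p.Prime := ⟨hp⟩
  rcases hmp.eq_or_lt with rfl | hlt
  · have : k = 0 := by
      by_contra hk0
      have := Nat.le_mul_of_pos_left m (Nat.pos_of_ne_zero hk0)
      omega
    simp [this]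
  · have hm0 : (m : ZMod p) ≠ 0 := by
      rw [Ne, ZMod.natCast_eq_zero_iff]
      exact Nat.not_dvd_of_pos_of_lt hm hlt
    push_cast
    field_simp

/-- **Fibers of `x ↦ lift_p x mod m` and their dilates.**
Let `p` be prime and `m ≤ p`, and define `f : Z_p → Z_m` by `f x = (lift_p x : ZMod m)`.
For every `y ∈ Z_m` there is `i < m` with
`f⁻¹(y) = {(i + k·m) mod p : 0 ≤ k < (p − i)/m}`, and `m⁻¹·f⁻¹(y)` is an interval
in `Z_p` of size at most `⌈p/m⌉`. -/
theorem fiber_is_dilated_interval (p m : ℕ) [NeZero p] [NeZero m]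
    (hp : p.Prime) (hmp : m ≤ p) (y : ZMod m) :
    ∃ i : ℕ, i < m ∧
      Finset.univ.filter (fun x : ZMod p => ((ZMod.val x : ℕ) : ZMod m) = y)
        = (Finset.range (Nat.ceil (((p : ℚ) - (i : ℚ)) / (m : ℚ)))).image
            (fun k : ℕ => ((i + k * m : ℕ) : ZMod p)) ∧
      ∃ (t : ℤ) (s : ℕ), s ≤ Nat.ceil ((p : ℚ) / (m : ℚ)) ∧
        (Finset.univ.filter (fun x : ZMod p => ((ZMod.val x : ℕ) : ZMod m) = y)).image
            (fun z => ((m : ZMod p))⁻¹ * z)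
          = Ival p t s := by
  refine ⟨y.val, y.val_lt, filter_val_cast_eq_image p m y,
    (((m : ZMod p)⁻¹ * (y.val : ZMod p)).val : ℤ),
    Nat.ceil (((p : ℚ) - (y.val : ℚ)) / (m : ℚ)), ?_, ?_⟩
  · gcongr
    exact sub_le_self _ (Nat.cast_nonneg _)
  · rw [filter_val_cast_eq_image p m y, Finset.image_image, Ival]
    refine Finset.image_congr fun k hk => ?_
    rw [Finset.mem_coe, Finset.mem_range, lt_ceil_sub_div_iff (NeZero.pos m)] at hk
    rw [Function.comp_apply, inv_mul_natCast_add_mul hp (NeZero.pos m) hmp hk]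
    push_cast
    rw [ZMod.natCast_zmod_val]
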